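/- arXiv:2507.17124 — 9 statements merged into one kernel-verified Lean document; each statement's English description precedes it below -/
import Mathlib

section
/- Let λ be an infinite cardinal and let 𝓘 be a barely independent family over λ. Then every uniform ultrafilter 𝓤 on λ has character at least |𝓘|; that is, every base 𝓑 of 𝓤 satisfies |𝓑| ≥ |𝓘|. -/
open Cardinal Set

/-- The boolean combination `⋂_{A ∈ 𝓐} A^{h(A)}`, where `A^0 = A` and `A^1` is the
complement of `A`. -/
def BoolComb {α : Type} (𝓐 : Set (Set α)) (h : Set α → Fin 2) : Set α :=
  ⋂ A ∈ 𝓐, if h A = 0 then A else Aᶜ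

/-- A family `I` of subsets of a set `α` (of cardinality `λ = #α`) is `κ`-barely independent
over `α` if all its members have cardinality `#α`, `|I| ≥ κ`, every boolean combination of
fewer than `κ` members has cardinality `#α`, and every boolean combination of exactly `κ`
members has cardinality `< #α`. -/
def KBarelyIndependent {α : Type} (κ : Cardinal) (I : Set (Set α)) : Prop :=
  κ ≤ #I ∧ (∀ A ∈ I, #A = #α) ∧
  (∀ 𝓐 ⊆ I, 𝓐.Nonempty → #𝓐 < κ → ∀ h : Set α → Fin 2, #(BoolComb 𝓐 h) = #α) ∧
  (∀ 𝓐 ⊆ I, #𝓐 = κ → ∀ h : Set α → Fin 2, #(BoolComb 𝓐 h) < #α)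

/-- If `I` is a barely independent (i.e. `ℵ₀`-barely independent) family over an infinite
set `α`, then every base of every uniform ultrafilter on `α` has cardinality at least `|I|`;
that is, every uniform ultrafilter on `α` has character at least `|I|`. -/
theorem stmt1 {α : Type} (hα : ℵ₀ ≤ #α) (I : Set (Set α))
    (hI : KBarelyIndependent ℵ₀ I)
    (𝓤 : Ultrafilter α) (huniform : ∀ U ∈ 𝓤, #U = #α)
    (B : Set (Set α)) (hBsub : ∀ b ∈ B, b ∈ 𝓤) (hbase : ∀ U ∈ 𝓤, ∃ b ∈ B, b ⊆ U) :
    #I ≤ #B := by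
  classical
  let h : Set α → Fin 2 := fun A => if A ∈ 𝓤 then 0 else 1
  have hmem : ∀ A, (if h A = 0 then A else Aᶜ) ∈ 𝓤 := by
    intro A
    by_cases hA : A ∈ 𝓤
    · simp [h, hA]
    · simpa [h, hA] using Ultrafilter.compl_mem_iff_notMem.2 hA
  choose b hbB hbA using fun A => hbase _ (hmem A)
  let f : I → B := fun A => ⟨b A, hbB A⟩
  have : Infinite I := Cardinal.aleph0_le_mk_iff.1 hI.1
  by_contra! hlt
  obtain ⟨c, hc⟩ : ∃ c, Infinite (f ⁻¹' {c}) := by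
    cases finite_or_infinite B with
    | inl _ => exact Finite.exists_infinite_fiber f
    | inr _ => exact Cardinal.exists_infinite_fiber f hlt
  let g : ℕ → Set α := fun n => (Infinite.natEmbedding (f ⁻¹' {c}) n : I)
  have hg : Function.Injective g :=
    Subtype.val_injective.comp
      (Subtype.val_injective.comp (Infinite.natEmbedding (f ⁻¹' {c})).injective)
  have hcard : #(range g) = ℵ₀ := by
    rw [Cardinal.mk_range_eq g hg, Cardinal.mk_nat]
  have hsub : range g ⊆ I := by
    rintro _ ⟨n, rfl⟩
    exact Subtype.property _
  have hcsub : (c : Set α) ⊆ BoolComb (range g) h := by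
    refine subset_iInter₂ ?_
    rintro _ ⟨n, rfl⟩
    have hfib : b (g n) = c :=
      congrArg Subtype.val (Infinite.natEmbedding (f ⁻¹' {c}) n).property
    exact hfib ▸ hbA (g n)
  exact (hI.2.2.2 _ hsub hcard h).ne
    (huniform _ (Filter.mem_of_superset (hBsub c c.property) hcsub))
end

section
/- Let 𝓘 be a family of nonempty subsets of ω such that for every nonempty finite subfamily 𝓐 ⊆ 𝓘 the intersection ⋂_{A ∈ 𝓐} (ω \ A) is infinite, and suppose that the set of minima {min A : A ∈ 𝓘} is unbounded in ω. Then there exists a countably infinite subfamily 𝓐 ⊆ 𝓘 such that ⋂_{A ∈ 𝓐} (ω \ A) is infinite. -/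
open Set

/-- If `I` is a family of nonempty subsets of `ℕ` such that the intersection of the
complements of any nonempty finite subfamily is infinite, and the set of minima of members
of `I` is unbounded in `ℕ`, then there is a countably infinite subfamily `𝓐 ⊆ I` such that
`⋂_{A ∈ 𝓐} (ℕ \ A)` is infinite. -/
theorem stmt3 (I : Set (Set ℕ)) (hne : ∀ A ∈ I, A.Nonempty)
    (hfin : ∀ 𝓐 ⊆ I, 𝓐.Nonempty → 𝓐.Finite → (⋂ A ∈ 𝓐, Aᶜ).Infinite)
    (hmin : ∀ n : ℕ, ∃ A ∈ I, n < sInf A) :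
    ∃ 𝓐 ⊆ I, 𝓐.Countable ∧ 𝓐.Infinite ∧ (⋂ A ∈ 𝓐, Aᶜ).Infinite := by
  obtain ⟨f, hP, hr⟩ := exists_seq_of_forall_finset_exists
    (fun p : Set ℕ × ℕ => p.1 ∈ I ∧ p.2 ∉ p.1 ∧ sInf p.1 ≤ p.2)
    (fun p q => p.2 < sInf q.1 ∧ q.2 ∉ p.1) (by
      intro s hs
      obtain ⟨B, hB, hsB⟩ := hmin (s.sup Prod.snd)
      have hsub : insert B (Prod.fst '' (s : Set (Set ℕ × ℕ))) ⊆ I := by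
        rintro A (rfl | ⟨p, hp, rfl⟩)
        · exact hB
        · exact (hs p hp).1
      obtain ⟨y, hy, hBy⟩ := (hfin _ hsub (insert_nonempty _ _)
        ((s.finite_toSet.image _).insert B)).exists_gt (sInf B)
      rw [mem_iInter₂] at hy
      exact ⟨(B, y), ⟨hB, hy B (mem_insert _ _), hBy.le⟩, fun p hp =>
        ⟨(Finset.le_sup (f := Prod.snd) hp).trans_lt hsB,
          hy p.1 (mem_insert_of_mem _ ⟨p, hp, rfl⟩)⟩⟩)
  have hmin_mono : StrictMono fun n => sInf (f n).1 := fun m n hmn =>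
    (hP m).2.2.trans_lt (hr m n hmn).1
  have hpt_mono : StrictMono fun n => (f n).2 := fun m n hmn =>
    (hr m n hmn).1.trans_le (hP n).2.2
  have hinj : Function.Injective fun n => (f n).1 :=
    Function.Injective.of_comp (f := sInf) hmin_mono.injective
  refine ⟨range fun n => (f n).1, range_subset_iff.2 fun n => (hP n).1,
    countable_range _, infinite_range_of_injective hinj,
    (infinite_range_of_injective hpt_mono.injective).mono ?_⟩
  rintro _ ⟨n, rfl⟩
  rw [mem_iInter₂]
  rintro _ ⟨m, rfl⟩
  rcases lt_trichotomy m n with h | rfl | h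
  · exact (hr m n h).2
  · exact (hP m).2.1
  · exact Nat.notMem_of_lt_sInf (hr n m h).1
end

section
/- Let κ and λ be infinite cardinals with κ ≤ cof(λ). If there is a κ-barely independent family over cof(λ) of cardinality μ, then there is a κ-barely independent family over λ of cardinality μ. -/
open Cardinal Set

/-- A union of fewer than `cof c` sets of cardinality `< c` has cardinality `< c`. -/
theorem mk_iUnion_lt_of_lt_cof_ord {α ι : Type} {c : Cardinal} (hc : ℵ₀ ≤ c)
    (hι : #ι < c.ord.cof) (f : ι → Set α) (hf : ∀ i, #(f i) < c) : #(⋃ i, f i) < c :=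
  (mk_iUnion_le f).trans_lt <|
    mul_lt_of_lt hc (hι.trans_le (Ordinal.cof_ord_le c)) (iSup_lt_of_lt_cof_ord hι hf)

/-- A set of cardinality `c` can be mapped onto a set of cardinality `cof c` so that preimages of
full-size sets have full size, and preimages of smaller sets are smaller. -/
theorem exists_surjective_mk_preimage {L T : Type} (hL : ℵ₀ ≤ #L) (hT : #T = (#L).ord.cof) :
    ∃ f : L → T, Function.Surjective f ∧ (∀ S : Set T, #S = #T → #(f ⁻¹' S) = #L) ∧
      ∀ S : Set T, #S < #T → #(f ⁻¹' S) < #L := by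
  obtain ⟨_, _, hLo⟩ := exists_ord_eq_type_lt L
  obtain ⟨_, _, hTo⟩ := exists_ord_eq_type_lt T
  obtain ⟨s, hs, hsc⟩ := Order.exists_cof_eq L
  have hTinf : ℵ₀ ≤ #T := by
    rw [hT, Ordinal.aleph0_le_cof_iff, Ordinal.one_lt_cof_iff]
    exact isSuccLimit_ord hL
  have hsT : #T = #s := by rw [hsc, hT, hLo, Ordinal.cof_type]
  obtain ⟨e⟩ := Cardinal.eq.1 hsT
  let F : T → Set L := fun i => ⋃ j : Iic i, Iic (e j : L)
  have hF : ∀ i, #(F i) < #L := fun i =>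
    mk_iUnion_lt_of_lt_cof_ord hL (hT ▸ mk_Iic_lt i hTo hTinf) _ fun j => mk_Iic_lt _ hLo hL
  let p : (Σ i, F i) → T := Sigma.fst
  have hfib : ∀ i, #(p ⁻¹' {i}) < #L := fun i =>
    (mk_le_of_surjective (f := fun x : F i => (⟨⟨i, x⟩, rfl⟩ : p ⁻¹' {i})) <| by
      rintro ⟨⟨_, x⟩, rfl⟩
      exact ⟨x, rfl⟩).trans_lt (hF i)
  have hXle : #(Σ i, F i) ≤ #L := by
    rw [mk_sigma]
    refine (sum_le_mk_mul_iSup _).trans ?_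
    refine (mul_le_mul' (hT.le.trans (Ordinal.cof_ord_le _))
      (ciSup_le' fun i => (hF i).le)).trans ?_
    exact (mul_eq_self hL).le
  have hbig : ∀ S : Set T, #S = #T → #L ≤ #(p ⁻¹' S) := by
    intro S hS
    have hub : ∀ j, ∃ i ∈ S, j ≤ i := by
      intro j
      by_contra! h
      exact ((mk_le_mk_of_subset (t := Iio j) h).trans_lt (mk_Iio_lt j hTo)).ne hS
    refine mk_le_of_surjective (f := fun x : p ⁻¹' S => (x.1.2 : L)) fun x => ?_
    obtain ⟨y, hy, hxy⟩ := hs x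
    obtain ⟨i, hi, hji⟩ := hub (e.symm ⟨y, hy⟩)
    exact ⟨⟨⟨i, x, mem_iUnion.2 ⟨⟨_, hji⟩, by simpa using hxy⟩⟩, hi⟩, rfl⟩
  have hX : #L = #(Σ i, F i) := le_antisymm ((hbig univ mk_univ).trans (mk_set_le _)) hXle
  obtain ⟨g⟩ := Cardinal.eq.1 hX
  have hg : ∀ S : Set T, #(p ∘ g ⁻¹' S) = #(p ⁻¹' S) := fun S =>
    mk_preimage_equiv g (p ⁻¹' S)
  refine ⟨p ∘ g, ?_, fun S hS => ?_, fun S hS => ?_⟩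
  · refine Function.Surjective.comp (fun i => ?_) g.surjective
    exact ⟨⟨i, e i, mem_iUnion.2 ⟨⟨i, le_rfl⟩, mem_Iic.2 le_rfl⟩⟩, rfl⟩
  · exact (mk_set_le _).antisymm ((hbig S hS).trans (hg S).ge)
  · rw [hg, ← biUnion_of_singleton S, biUnion_eq_iUnion, preimage_iUnion]
    exact mk_iUnion_lt_of_lt_cof_ord hL (hT ▸ hS) _ fun i => hfib i

theorem boolComb_image_preimage {L T : Type} (f : L → T) (𝓐 : Set (Set T)) (h : Set L → Fin 2) :
    BoolComb (preimage f '' 𝓐) h = f ⁻¹' BoolComb 𝓐 (h ∘ preimage f) := by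
  ext x
  simp only [BoolComb, biInter_image, preimage_iInter, mem_iInter, Function.comp_apply]
  refine forall₂_congr fun A _ => ?_
  split_ifs <;> rfl

/-- Barely independent families pull back along surjections which preserve full-size sets and
small sets under preimages. -/
theorem KBarelyIndependent.image_preimage {L T : Type} {κ : Cardinal} {I : Set (Set T)}
    (hI : KBarelyIndependent κ I) {f : L → T} (hf : Function.Surjective f)
    (hbig : ∀ S : Set T, #S = #T → #(f ⁻¹' S) = #L)
    (hsmall : ∀ S : Set T, #S < #T → #(f ⁻¹' S) < #L) :
    KBarelyIndependent κ (preimage f '' I) := by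
  obtain ⟨hκ, hmem, hlt, heq⟩ := hI
  have hinj : Function.Injective (preimage f) := hf.preimage_injective
  refine ⟨by rwa [mk_image_eq hinj], ?_, ?_, ?_⟩
  · rintro _ ⟨A, hA, rfl⟩
    exact hbig A (hmem A hA)
  · intro 𝓑 h𝓑 hne hcard h
    obtain ⟨𝓐, h𝓐, rfl⟩ := subset_image_iff.1 h𝓑
    rw [boolComb_image_preimage]
    rw [mk_image_eq hinj] at hcard
    exact hbig _ (hlt 𝓐 h𝓐 hne.of_image hcard _)
  · intro 𝓑 h𝓑 hcard h
    obtain ⟨𝓐, h𝓐, rfl⟩ := subset_image_iff.1 h𝓑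
    rw [boolComb_image_preimage]
    rw [mk_image_eq hinj] at hcard
    exact hsmall _ (heq 𝓐 h𝓐 hcard _)

/-- If `κ ≤ cof(lam)` are infinite cardinals and there is a `κ`-barely independent family
over `cof(lam)` of cardinality `μ`, then there is a `κ`-barely independent family over `lam`
of cardinality `μ`. -/
theorem stmt4 (κ lam μ : Cardinal) (hκ : ℵ₀ ≤ κ) (hlam : ℵ₀ ≤ lam)
    (hκcof : κ ≤ lam.ord.cof)
    (hex : ∃ I : Set (Set (lam.ord.cof).out), KBarelyIndependent κ I ∧ #I = μ) :
    ∃ I : Set (Set lam.out), KBarelyIndependent κ I ∧ #I = μ := by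
  obtain ⟨I, hI, hμ⟩ := hex
  obtain ⟨f, hf, hbig, hsmall⟩ :=
    exists_surjective_mk_preimage (L := lam.out) (T := (lam.ord.cof).out) (by simpa) (by simp)
  exact ⟨preimage f '' I, hI.image_preimage hf hbig hsmall,
    (mk_image_eq hf.preimage_injective).trans hμ⟩
end

section
/- Let κ and λ be infinite regular cardinals with λ > 2^κ. Then there is no κ-barely independent family over λ. -/
open Cardinal Set

/-- If `κ` and `lam` are infinite regular cardinals with `lam > 2^κ`, then there is no
`κ`-barely independent family over `lam`. -/
theorem stmt5 (κ lam : Cardinal) (hκ : ℵ₀ ≤ κ) (hlam : ℵ₀ ≤ lam)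
    (hκreg : κ.IsRegular) (hlamreg : lam.IsRegular) (hgt : 2 ^ κ < lam) :
    ¬ ∃ I : Set (Set lam.out), KBarelyIndependent κ I := by
  rintro ⟨I, hI, -, -, hsmall⟩
  obtain ⟨𝓐, h𝓐I, h𝓐⟩ := le_mk_iff_exists_subset.1 hI
  let f : lam.out → Set 𝓐 := fun x => {A | x ∈ (A : Set lam.out)}
  obtain ⟨a, ha⟩ : ∃ a, #(f ⁻¹' {a}) = #lam.out := by
    apply infinite_pigeonhole f
    · rwa [mk_out]
    · rwa [mk_out, hlamreg.cof_ord, mk_set, h𝓐]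
  classical
  let h : Set lam.out → Fin 2 := fun A => if ∃ hA : A ∈ 𝓐, (⟨A, hA⟩ : 𝓐) ∈ a then 0 else 1
  refine (hsmall 𝓐 h𝓐I h𝓐 h).not_ge (ha.symm.trans_le (mk_le_mk_of_subset ?_))
  rintro x rfl
  refine mem_iInter₂.2 fun A hA => ?_
  by_cases hx : x ∈ A <;> simp [h, f, hA, hx]
end

section
/- Let κ be an infinite cardinal such that 2^κ = κ⁺. Then there exists a κ⁺-barely independent family over κ⁺ (and it can be taken of cardinality κ⁺). -/
open Cardinal Set

universe u

/-- A family of at most `κ` sets, each of cardinality at least `κ`, has an injective choice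
function. -/
theorem exists_injective_choice {K L : Type u} {κ : Cardinal.{u}} (hK : #K ≤ κ)
    (S : K → Set L) (hS : ∀ k, κ ≤ #(S k)) :
    ∃ f : K → L, Function.Injective f ∧ ∀ k, f k ∈ S k := by
  obtain ⟨_, _, hord⟩ := exists_ord_eq_type_lt K
  have key : ∀ (k : K) (g : Iio k → L), ∃ x ∈ S k, x ∉ range g := by
    intro k g
    by_contra! hsub
    exact (((hS k).trans (mk_le_mk_of_subset hsub)).trans mk_range_le).not_gt
      ((mk_Iio_lt k hord).trans_le hK)
  choose F hF hFr using key
  let f : K → L := WellFoundedLT.fix fun k ih => F k fun j => ih j.1 j.2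
  have hf : ∀ k, f k = F k fun j => f j.1 := fun k => WellFoundedLT.fix_eq _ k
  have hne : ∀ j k, j < k → f j ≠ f k := by
    intro j k hjk he
    apply hFr k fun j => f j.1
    rw [← hf k]
    exact ⟨⟨j, hjk⟩, he⟩
  refine ⟨f, fun j k he => ?_, fun k => ?_⟩
  · rcases lt_trichotomy j k with h | h | h
    · exact absurd he (hne _ _ h)
    · exact h
    · exact absurd he.symm (hne _ _ h)
  · rw [hf k]
    exact hF _ _

/-- At most `κ` sets of cardinality at least `κ` can be split simultaneously by prescribing a set
on at most `κ` points. -/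
theorem exists_splitting_prescription {K L : Type u} {κ : Cardinal.{u}} (hκ : ℵ₀ ≤ κ)
    (hK : #K ≤ κ) (S : K → Set L) (hS : ∀ k, κ ≤ #(S k)) :
    ∃ X C : Set L, #X ≤ κ ∧ ∀ B : Set L, (∀ x ∈ X, x ∈ B ↔ x ∈ C) →
      ∀ k, ¬ S k ⊆ B ∧ ¬ S k ⊆ Bᶜ := by
  have hKB : #(K × Bool) ≤ κ := by
    simp only [mk_prod, lift_uzero, mk_bool, lift_ofNat]
    exact mul_le_of_le hκ hK ((natCast_le_aleph0 (n := 2)).trans hκ)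
  obtain ⟨f, hf, hfS⟩ := exists_injective_choice hKB (fun p => S p.1) fun p => hS p.1
  refine ⟨range f, range fun k => f (k, true), mk_range_le.trans hKB, fun B hB k => ⟨?_, ?_⟩⟩
  · intro hsub
    obtain ⟨j, hj⟩ := (hB (f (k, false)) ⟨_, rfl⟩).1 (hsub (hfS (k, false)))
    simpa using hf hj
  · intro hsub
    exact hsub (hfS (k, true)) ((hB _ ⟨_, rfl⟩).2 ⟨k, rfl⟩)

/-- If `(κ⁺)^κ = κ⁺`, then the subsets of `L` of cardinality at most `κ` can be enumerated
along `L`, where `#L = κ⁺`, with every one of them occurring `κ⁺` many times. -/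
theorem exists_enumeration_of_bounded_sets {L : Type u} {κ : Cardinal.{u}} (hκ : ℵ₀ ≤ κ)
    (hL : #L ^ κ = #L) (hLκ : κ < #L) :
    ∃ e : L → Set L, ∀ T : Set L, #T ≤ κ → #{x | e x = T} = #L := by
  have hinf : ℵ₀ ≤ #L := hκ.trans hLκ.le
  have : Infinite L := infinite_iff.2 hinf
  have hcard : #({T : Set L // #T ≤ κ} × L) = #L := by
    rw [mk_prod, lift_id, lift_id]
    refine mul_eq_right hinf ((mk_bounded_set_le_of_infinite L κ).trans hL.le) ?_
    exact mk_ne_zero_iff.2 ⟨⟨∅, by simp⟩⟩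
  obtain ⟨g⟩ := Cardinal.eq.1 hcard
  refine ⟨fun x => (g.symm x).1, fun T hT => le_antisymm (mk_set_le _) ?_⟩
  refine mk_le_of_injective (f := fun y => ⟨g (⟨T, hT⟩, y), by simp⟩) fun y z hyz => ?_
  simpa using hyz

/-- If `κ⁺ = 2^κ`, there is a `κ⁺`-indexed family of subsets of `κ⁺` which realizes every pattern
on `κ` indices `κ⁺` many times, while every set of cardinality `κ` is split by all but at most `κ`
members. -/
theorem exists_independent_splitting_family {L : Type u} {κ : Cardinal.{u}} (hκ : ℵ₀ ≤ κ)
    (hCH : 2 ^ κ = Order.succ κ) (hL : #L = Order.succ κ) :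
    ∃ A : L → Set L,
      (∀ D T : Set L, #D ≤ κ → #{x | ∀ i ∈ D, x ∈ A i ↔ i ∈ T} = #L) ∧
      ∀ S : Set L, #S = κ → #{i | S ⊆ A i ∨ S ⊆ (A i)ᶜ} ≤ κ := by
  have hLκ : κ < #L := hL ▸ Order.lt_succ κ
  have hpow : #L ^ κ = #L := by rw [hL, ← hCH, ← power_mul, mul_eq_self hκ]
  have : Infinite L := infinite_iff.2 (hκ.trans hLκ.le)
  obtain ⟨e, he⟩ := exists_enumeration_of_bounded_sets hκ hpow hLκ
  obtain ⟨_, _, hord⟩ := exists_ord_eq_type_lt L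
  have hle : ∀ {c : Cardinal.{u}}, c < #L → c ≤ κ := fun h => Order.lt_succ_iff.1 (hL ▸ h)
  have hsplit : ∀ i : L, ∃ X C : Set L, #X ≤ κ ∧ ∀ B : Set L, (∀ x ∈ X, x ∈ B ↔ x ∈ C) →
      ∀ k : {k : L // k < i ∧ κ ≤ #(e k)}, ¬ e k ⊆ B ∧ ¬ e k ⊆ Bᶜ := fun i =>
    exists_splitting_prescription hκ
      ((mk_le_mk_of_subset fun _ h => h.1).trans (hle (mk_Iio_lt i hord)))
      (fun k => e k.1) fun k => k.2.2
  choose X C hX hC using hsplit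
  let A : L → Set L := fun i => {x | (x ∈ X i ∧ x ∈ C i) ∨ (x ∉ X i ∧ i ∈ e x)}
  refine ⟨A, fun D T hD => le_antisymm (mk_set_le _) ?_, fun S hS => ?_⟩
  · have hU : #(⋃ i ∈ D, X i) ≤ κ :=
      (mk_biUnion_le X D).trans (mul_le_of_le hκ hD (ciSup_le' fun i => hX i))
    have hT := he (D ∩ T) ((mk_le_mk_of_subset inter_subset_left).trans hD)
    have hdiff : #L ≤ #({x | e x = D ∩ T} \ ⋃ i ∈ D, X i : Set L) := by
      by_contra! hlt
      have := le_mk_sdiff_add_mk {x | e x = D ∩ T} (⋃ i ∈ D, X i)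
      rw [hT] at this
      exact (this.trans (add_le_of_le hκ (hle hlt) hU)).not_gt hLκ
    refine hdiff.trans (mk_le_mk_of_subset ?_)
    rintro x ⟨hx, hxU⟩ i hi
    have hxi : x ∉ X i := fun h => hxU (mem_biUnion hi h)
    rw [mem_ofPred_eq] at hx
    simp [A, hxi, hx, hi]
  · obtain ⟨k, hk⟩ : {x | e x = S}.Nonempty := by
      rw [← mk_set_ne_zero_iff, he S hS.le]
      exact mk_ne_zero L
    rw [mem_ofPred_eq] at hk
    refine (mk_le_mk_of_subset ?_).trans (hle (mk_Iic_lt k hord (aleph0_le_mk L)))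
    intro i hi
    by_contra hki
    have := hC i (A i) (fun x hx => by simp [A, hx]) ⟨k, not_le.1 hki, by rw [hk, hS]⟩
    simp only [hk] at this
    exact hi.elim this.1 this.2

theorem mem_boolComb {α : Type} {𝓐 : Set (Set α)} {h : Set α → Fin 2} {x : α} :
    x ∈ BoolComb 𝓐 h ↔ ∀ A ∈ 𝓐, x ∈ A ↔ h A = 0 := by
  simp only [BoolComb, mem_iInter]
  refine forall₂_congr fun A _ => ?_
  split_ifs with hA <;> simp [hA]

/-- If `κ` is an infinite cardinal with `2^κ = κ⁺`, then there is a `κ⁺`-barely independent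
family over `κ⁺`, of cardinality `κ⁺`. -/
theorem stmt6 (κ : Cardinal) (hκ : ℵ₀ ≤ κ) (hCH : 2 ^ κ = Order.succ κ) :
    ∃ I : Set (Set (Order.succ κ).out),
      KBarelyIndependent (Order.succ κ) I ∧ #I = Order.succ κ := by
  have hL : #(Order.succ κ).out = Order.succ κ := mk_out _
  have : Nonempty (Order.succ κ).out := mk_ne_zero_iff.1 (by simp [hL])
  obtain ⟨A, hA, hsplit⟩ := exists_independent_splitting_family hκ hCH hL
  have hinj : Function.Injective A := by
    intro i j hij
    by_contra hne
    have hD : #({i, j} : Set (Order.succ κ).out) ≤ κ :=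
      ((toFinite _).lt_aleph0.le).trans hκ
    obtain ⟨x, hx⟩ : {x | ∀ k ∈ ({i, j} : Set _), x ∈ A k ↔ k ∈ ({i} : Set _)}.Nonempty := by
      rw [← mk_set_ne_zero_iff, hA _ _ hD]
      exact mk_ne_zero _
    have hi := hx i (by simp)
    have hj := hx j (by simp)
    rw [← hij, hi] at hj
    exact hne (by simpa [eq_comm] using hj)
  have hI : #(range A) = Order.succ κ := (mk_range_eq A hinj).trans hL
  have hsmall : ∀ 𝓐 ⊆ range A, #𝓐 < Order.succ κ → ∀ h : Set _ → Fin 2,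
      #(BoolComb 𝓐 h) = #(Order.succ κ).out := by
    intro 𝓐 h𝓐 hcard h
    rw [← hA (A ⁻¹' 𝓐) {i | h (A i) = 0} (by
      rw [mk_preimage_of_injective_of_subset_range A 𝓐 hinj h𝓐]
      exact Order.lt_succ_iff.1 hcard)]
    congr 2
    ext x
    rw [mem_boolComb]
    refine ⟨fun hx i hi => hx _ hi, fun hx B hB => ?_⟩
    obtain ⟨i, rfl⟩ := h𝓐 hB
    exact hx i hB
  refine ⟨range A, ⟨hI.ge, fun B hB => ?_, fun 𝓐 h𝓐 _ => hsmall 𝓐 h𝓐,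
    fun 𝓐 h𝓐 hcard h => ?_⟩, hI⟩
  · have hlt : #({B} : Set (Set (Order.succ κ).out)) < Order.succ κ :=
      ((toFinite _).lt_aleph0.trans_le hκ).trans (Order.lt_succ κ)
    simpa [BoolComb] using hsmall {B} (singleton_subset_iff.2 hB) hlt fun _ => 0
  · by_contra! hge
    rw [hL] at hge
    obtain ⟨S, hS, hSκ⟩ := le_mk_iff_exists_subset.1 ((Order.le_succ κ).trans hge)
    have hsub : A ⁻¹' 𝓐 ⊆ {i | S ⊆ A i ∨ S ⊆ (A i)ᶜ} := by
      intro i hi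
      have hmem : ∀ x ∈ S, x ∈ A i ↔ h (A i) = 0 := fun x hx => mem_boolComb.1 (hS hx) _ hi
      by_cases h0 : h (A i) = 0
      · exact Or.inl fun x hx => (hmem x hx).2 h0
      · exact Or.inr fun x hx hxA => h0 ((hmem x hx).1 hxA)
    have hle := (mk_le_mk_of_subset hsub).trans (hsplit S hSκ)
    rw [mk_preimage_of_injective_of_subset_range A 𝓐 hinj h𝓐, hcard] at hle
    exact hle.not_gt (Order.lt_succ κ)
end

section
/- Let κ, λ, μ be infinite cardinals with κ ≤ λ and κ ≤ μ. If there is a κ-barely independent family over μ of cardinality λ, then 𝔯(κ,λ) ≥ cof(μ); equivalently, for every family 𝓡 of κ-sized subsets of λ with |𝓡| < cof(μ), there exists S ⊆ λ that splits every member of 𝓡. -/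
open Cardinal Set

/-- `S` splits `R` if both `R ∩ S` and `R \ S` are infinite. (`R` reaps `S` otherwise.) -/
def Splits {α : Type} (S R : Set α) : Prop := (R ∩ S).Infinite ∧ (R \ S).Infinite

/-- The generalized reaping number `𝔯(κ, λ)`: the least cardinality of a family `R` of
`κ`-sized subsets of `λ` such that every `S ⊆ λ` is reaped by some member of `R`. -/
noncomputable def reapingNumber (κ lam : Cardinal) : Cardinal :=
  sInf {c | ∃ R : Set (Set lam.out), #R = c ∧ (∀ r ∈ R, #r = κ) ∧
    ∀ S : Set lam.out, ∃ r ∈ R, ¬ Splits S r}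

/-- A family of sets, each at least as large as the index type, has an injective choice
function. -/
theorem exists_injective_forall_mem.{u} {ι α : Type u} (s : ι → Set α) (hs : ∀ i, #ι ≤ #(s i)) :
    ∃ f : ι → α, Function.Injective f ∧ ∀ i, f i ∈ s i := by
  obtain ⟨r, wo, hr⟩ := Cardinal.exists_ord_eq ι
  have hlt (i : ι) : #{j // r j i} < #ι := Cardinal.card_typein_lt i hr
  have hne (i : ι) (g : {j // r j i} → α) : (s i \ range g).Nonempty :=
    Cardinal.sdiff_nonempty_of_mk_lt_mk ((mk_range_le.trans_lt (hlt i)).trans_le (hs i))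
  let F (i : ι) (g : ∀ j, r j i → α) : α := (hne i fun j => g j.1 j.2).some
  let f : ι → α := wo.wf.fix F
  have hf (i : ι) : f i ∈ s i \ range fun j : {j // r j i} => f j.1 := by
    have h : f i = F i fun j _ => f j := wo.wf.fix_eq F i
    rw [h]
    exact (hne i fun j => f j.1).some_mem
  refine ⟨f, fun i j hij => ?_, fun i => (hf i).1⟩
  rcases trichotomous_of r i j with h | h | h
  · exact ((hf j).2 ⟨⟨i, h⟩, hij⟩).elim
  · exact h
  · exact ((hf i).2 ⟨⟨j, h⟩, hij.symm⟩).elim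

/-- At most `κ` many sets of infinite cardinality `κ` can be split simultaneously. -/
theorem exists_splits_of_mk_le {α : Type} {κ : Cardinal} (hκ : ℵ₀ ≤ κ) (R : Set (Set α))
    (hR : ∀ r ∈ R, #r = κ) (hle : #R ≤ κ) : ∃ S : Set α, ∀ r ∈ R, Splits S r := by
  obtain ⟨f, hinj, hf⟩ := exists_injective_forall_mem
    (fun i : R × ℕ × Bool => (i.1 : Set α)) (fun i => by
      rw [hR _ i.1.2, mk_prod, lift_id, lift_id]
      refine mul_le_of_le hκ hle ?_
      exact mk_le_aleph0.trans hκ)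
  refine ⟨f '' {i | i.2.2 = true}, fun r hr => ⟨?_, ?_⟩⟩
  · refine infinite_of_injective_forall_mem (f := fun n : ℕ => f (⟨r, hr⟩, n, true)) ?_ ?_
    · intro m n h
      simpa using hinj h
    · exact fun n => ⟨hf (⟨r, hr⟩, n, true), mem_image_of_mem f rfl⟩
  · refine infinite_of_injective_forall_mem (f := fun n : ℕ => f (⟨r, hr⟩, n, false)) ?_ ?_
    · intro m n h
      simpa using hinj h
    · refine fun n => ⟨hf (⟨r, hr⟩, n, false), ?_⟩
      rintro ⟨i, hi, h⟩
      rw [hinj h] at hi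
      exact Bool.false_ne_true hi

/-- A union of fewer than `cof μ` sets of cardinality less than `μ` has cardinality less
than `μ`. -/
theorem mk_iUnion_lt_of_lt_cof.{u} {ι α : Type u} {μ : Cardinal.{u}} (hμ : ℵ₀ ≤ μ)
    (hι : #ι < μ.ord.cof) (t : ι → Set α) (ht : ∀ i, #(t i) < μ) : #(⋃ i, t i) < μ :=
  (mk_iUnion_le t).trans_lt <| mul_lt_of_lt hμ (hι.trans_le (Ordinal.cof_ord_le μ))
    (iSup_lt_of_lt_cof_ord hι ht)

/-- If `κ < cof μ`, a `κ`-barely independent family over a set of cardinality `μ`, indexed by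
`α`, yields simultaneous splitting of fewer than `cof μ` many `κ`-sized subsets of `α`. -/
theorem KBarelyIndependent.exists_splits {α β : Type} {κ : Cardinal} (hκ : ℵ₀ ≤ κ)
    (hβ : ℵ₀ ≤ #β) (hκβ : κ < (#β).ord.cof) {I : Set (Set β)} (hI : KBarelyIndependent κ I)
    (e : α ≃ I) (R : Set (Set α)) (hR : ∀ r ∈ R, #r = κ) (hlt : #R < (#β).ord.cof) :
    ∃ S : Set α, ∀ r ∈ R, Splits S r := by
  let a (i : α) : Set β := e i
  have ha : Function.Injective a := Subtype.val_injective.comp e.injective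
  let t (j : Σ r : R, Finset (r : Set α) × Fin 2) : Set β :=
    BoolComb (a '' ((j.1 : Set α) \ Subtype.val '' (j.2.1 : Set (j.1 : Set α)))) fun _ => j.2.2
  have ht (j) : #(t j) < #β := by
    refine hI.2.2.2 _ ?_ ?_ _
    · rintro _ ⟨i, -, rfl⟩
      exact (e i).2
    · have hr := hR _ j.1.2
      have : Infinite (j.1 : Set α) := by rw [infinite_iff, hr]; exact hκ
      rw [mk_image_eq ha, ← hr]
      have hfin : #(Subtype.val '' (j.2.1 : Set (j.1 : Set α)) : Set α) < ℵ₀ :=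
        (j.2.1.finite_toSet.image _).lt_aleph0
      refine eq_of_add_eq_of_aleph0_le (a := #(Subtype.val '' (j.2.1 : Set (j.1 : Set α)) : Set α))
        ?_ (hfin.trans_le (hκ.trans_eq hr.symm)) (hκ.trans_eq hr.symm)
      rw [add_comm]
      exact mk_sdiff_add_mk (by rintro _ ⟨x, -, rfl⟩; exact x.2)
  have hcard : #(Σ r : R, Finset (r : Set α) × Fin 2) < (#β).ord.cof := by
    have hle (r : R) : #(Finset (r : Set α) × Fin 2) ≤ κ := by
      have hr := hR _ r.2
      have : Infinite (r : Set α) := by rw [infinite_iff, hr]; exact hκ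
      rw [mk_prod, lift_id, lift_id, mk_finset_of_infinite, hr]
      exact mul_le_of_le hκ le_rfl (mk_le_aleph0.trans hκ)
    rw [mk_sigma]
    refine ((sum_le_sum _ _ hle).trans_eq (sum_const' _ _)).trans_lt ?_
    exact mul_lt_of_lt (hκ.trans hκβ.le) hlt hκβ
  obtain ⟨x, hx⟩ : ∃ x, x ∉ ⋃ j, t j := by
    by_contra! h
    have := mk_iUnion_lt_of_lt_cof hβ hcard t ht
    rw [eq_univ_of_forall h, mk_univ] at this
    exact this.false
  rw [mem_iUnion, not_exists] at hx
  refine ⟨{i | x ∈ a i}, fun r hr => ⟨fun hfin => ?_, fun hfin => ?_⟩⟩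
  · have hF := hfin.preimage (f := ((↑) : r → α)) Subtype.val_injective.injOn
    refine hx ⟨⟨r, hr⟩, hF.toFinset, 1⟩ (mem_iInter₂.2 ?_)
    rintro _ ⟨i, ⟨hi, hi'⟩, rfl⟩ hxi
    exact hi' ⟨⟨i, hi⟩, by simpa using hxi, rfl⟩
  · have hF := hfin.preimage (f := ((↑) : r → α)) Subtype.val_injective.injOn
    refine hx ⟨⟨r, hr⟩, hF.toFinset, 0⟩ (mem_iInter₂.2 ?_)
    rintro _ ⟨i, ⟨hi, hi'⟩, rfl⟩
    by_contra hxi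
    exact hi' ⟨⟨i, hi⟩, by simpa using hxi, rfl⟩

/-- The family of all `κ`-sized subsets of an infinite set of cardinality at least `κ` is
reaping. -/
theorem exists_not_splits {α : Type} {κ : Cardinal} (hα : ℵ₀ ≤ #α) (hκα : κ ≤ #α) (S : Set α) :
    ∃ r : Set α, #r = κ ∧ ¬ Splits S r := by
  by_cases h : κ ≤ #S
  · obtain ⟨r, hrS, hr⟩ := le_mk_iff_exists_subset.1 h
    refine ⟨r, hr, fun hs => hs.2 ?_⟩
    rw [sdiff_eq_empty.2 hrS]
    exact finite_empty
  · have : Infinite α := infinite_iff.2 hα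
    have hc := mk_compl_of_infinite S ((not_le.1 h).trans_le hκα)
    obtain ⟨r, hrS, hr⟩ := le_mk_iff_exists_subset.1 (hκα.trans_eq hc.symm)
    refine ⟨r, hr, fun hs => hs.1 ?_⟩
    rw [(disjoint_left.2 fun _ hx => hrS hx : Disjoint r S).inter_eq]
    exact finite_empty

/-- If `κ ≤ lam` and `κ ≤ μ` are infinite cardinals and there is a `κ`-barely independent
family over `μ` of cardinality `lam`, then `𝔯(κ, lam) ≥ cof(μ)`; equivalently, every family
of `κ`-sized subsets of `lam` of cardinality `< cof(μ)` admits a single set splitting all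
of its members. -/
theorem stmt8 (κ lam μ : Cardinal) (hκ : ℵ₀ ≤ κ) (hlam : ℵ₀ ≤ lam) (hμ : ℵ₀ ≤ μ)
    (hκlam : κ ≤ lam) (hκμ : κ ≤ μ)
    (hex : ∃ I : Set (Set μ.out), KBarelyIndependent κ I ∧ #I = lam) :
    μ.ord.cof ≤ reapingNumber κ lam ∧
    ∀ R : Set (Set lam.out), (∀ r ∈ R, #r = κ) → #R < μ.ord.cof →
      ∃ S : Set lam.out, ∀ r ∈ R, Splits S r := by
  have key : ∀ R : Set (Set lam.out), (∀ r ∈ R, #r = κ) → #R < μ.ord.cof →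
      ∃ S : Set lam.out, ∀ r ∈ R, Splits S r := by
    intro R hR hlt
    rcases le_or_gt (#R) κ with hle | hgt
    · exact exists_splits_of_mk_le hκ R hR hle
    · obtain ⟨I, hI, hIlam⟩ := hex
      obtain ⟨e⟩ := Cardinal.eq.1 ((mk_out lam).trans hIlam.symm)
      exact hI.exists_splits hκ (by rwa [mk_out]) (by rw [mk_out]; exact hgt.trans hlt) e R hR
        (by rwa [mk_out])
  refine ⟨le_csInf ?_ ?_, key⟩
  · refine ⟨_, {r | #r = κ}, rfl, fun r hr => hr, fun S => ?_⟩
    exact exists_not_splits (by rwa [mk_out]) (by rwa [mk_out]) S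
  · rintro _ ⟨R, rfl, hR, hreap⟩
    by_contra! hlt
    obtain ⟨S, hS⟩ := key R hR hlt
    obtain ⟨r, hr, hns⟩ := hreap S
    exact hns (hS r hr)
end

section
/- Let κ be an infinite regular cardinal, let μ = cof(2^κ), and let λ be an infinite cardinal with λ ≤ μ and λ^{<κ} ≤ μ. If 𝔯(κ,λ) = 2^κ, then there is a κ-barely independent family over μ of cardinality λ. -/
open Cardinal Set

/-- A set of cardinality at most `c` is the limit, along `c.ord.cof`, of subsets of cardinality
less than `c`. -/
theorem exists_filtration_of_mk_le {c : Cardinal} {X T : Type} (hX : #X ≤ c)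
    (hT : #T = c.ord.cof) (hinf : ℵ₀ ≤ #T) :
    ∃ F : T → Set X, (∀ t, #(F t) < c) ∧ ∀ x, #{t | x ∉ F t} < #T := by
  obtain ⟨f⟩ : Nonempty (X ↪ c.ord.ToType) := by
    rwa [← Cardinal.le_def, mk_ord_toType]
  obtain ⟨s, hs, hsc⟩ := Order.exists_cof_eq c.ord.ToType
  rw [Ordinal.cof_toType, ← hT] at hsc
  obtain ⟨e⟩ : Nonempty (T ≃ (#T).ord.ToType) := by
    rw [← Cardinal.eq, mk_ord_toType]
  obtain ⟨g⟩ : Nonempty ((#T).ord.ToType ≃ s) := by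
    rw [← Cardinal.eq, mk_ord_toType, hsc]
  have hIic (i : (#T).ord.ToType) : #(Iic i) < #T := by
    simpa using mk_Iic_lt i (by simp) (by simpa using hinf)
  refine ⟨fun t ↦ {x | ∃ i ≤ e t, f x ≤ g i}, fun t ↦ ?_, fun x ↦ ?_⟩
  · have hnc : ¬ IsCofinal ((fun i ↦ (g i : c.ord.ToType)) '' Iic (e t)) := fun h ↦ by
      have h1 := Order.cof_le h
      rw [Ordinal.cof_toType, ← hT] at h1
      exact ((h1.trans mk_image_le).trans_lt (hIic _)).false
    obtain ⟨y, hy⟩ := not_isCofinal_iff.1 hnc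
    have hsub : ∀ x ∈ {x | ∃ i ≤ e t, f x ≤ g i}, f x ∈ Iio y := by
      rintro x ⟨i, hi, hxi⟩
      exact hxi.trans_lt (hy _ ⟨i, hi, rfl⟩)
    calc _ ≤ #(Iio y) := mk_le_of_injective (f := fun x ↦ ⟨f x.1, hsub x.1 x.2⟩)
          fun a b hab ↦ Subtype.ext (f.injective (by simpa using hab))
      _ < c := by simpa using mk_Iio_lt y (by simp)
  · obtain ⟨y, hy, hxy⟩ := hs (f x)
    refine lt_of_le_of_lt ?_ (hIic (g.symm ⟨y, hy⟩))
    refine mk_le_of_injective (f := fun t ↦ ⟨e t.1, ?_⟩)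
      fun a b hab ↦ Subtype.ext (e.injective (by simpa using hab))
    by_contra hlt
    exact t.2 ⟨_, (not_le.1 hlt).le, by simpa using hxy⟩

/-- A set has at most `κ * |Λ|^{<κ}` subsets of cardinality less than `κ`. -/
theorem mk_subsets_lt_le {Λ : Type} {κ : Cardinal} (hΛ : ℵ₀ ≤ #Λ) :
    #{A : Set Λ // #A < κ} ≤ κ * #Λ ^< κ := by
  have hsurj : ∀ A : {A : Set Λ // #A < κ},
      ∃ x : Σ i : κ.ord.ToType, {B : Set Λ // #B ≤ #(Iio i)}, x.2.1 = A.1 := by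
    rintro ⟨A, hA⟩
    have hlt : (#A).ord < κ.ord := ord_lt_ord.2 hA
    have hlt' : (#A).ord < Ordinal.type (α := κ.ord.ToType) (· < ·) := by simpa using hlt
    refine ⟨⟨Ordinal.enum (α := κ.ord.ToType) (· < ·) ⟨_, hlt'⟩, A, ?_⟩, rfl⟩
    have hcard := Ordinal.card_typein (α := κ.ord.ToType) (r := (· < ·))
      (Ordinal.enum (α := κ.ord.ToType) (· < ·) ⟨_, hlt'⟩)
    rw [Ordinal.typein_enum, card_ord] at hcard
    exact hcard.le
  choose φ hφ using hsurj
  have hinj : Function.Injective φ := fun A B h ↦ Subtype.ext (by rw [← hφ A, ← hφ B, h])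
  refine (mk_le_of_injective hinj).trans ?_
  rw [mk_sigma]
  refine (sum_le_sum _ (fun _ ↦ #Λ ^< κ) fun i ↦ ?_).trans (by simp)
  refine (mk_bounded_set_le _ _).trans ?_
  rw [max_eq_left hΛ]
  exact le_powerlt _ (by simpa using mk_Iio_lt i (by simp))

theorem exists_fiber_mk_eq {T P : Type} (hT : ℵ₀ ≤ #T) (hP : #P ≤ #T) [Nonempty P] :
    ∃ p : T → P, ∀ x, #{t | p t = x} = #T := by
  obtain ⟨e⟩ : Nonempty (T ≃ T × P) := by
    rw [← Cardinal.eq, mk_prod, lift_id, lift_id, mul_eq_left hT hP (by simp)]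
  refine ⟨fun t ↦ (e t).2, fun x ↦ (mk_set_le _).antisymm ?_⟩
  exact mk_le_of_injective (f := fun t ↦ ⟨e.symm (t, x), by simp⟩)
    fun a b hab ↦ by simpa using hab

theorem mk_sdiff_eq_of_lt {α : Type} {B A : Set α} (hB : ℵ₀ ≤ #B) (hA : #A < #B) :
    #(B \ A : Set α) = #B := by
  refine (mk_le_mk_of_subset sdiff_subset).antisymm ?_
  by_contra! h
  exact ((le_mk_sdiff_add_mk B A).trans_lt (add_lt_of_lt hB h hA)).false

theorem exists_splits_of_mk_lt_reapingNumber {κ lam : Cardinal} {R : Set (Set lam.out)}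
    (hR : ∀ r ∈ R, #r = κ) (h : #R < reapingNumber κ lam) :
    ∃ S : Set lam.out, ∀ r ∈ R, Splits S r := by
  have := notMem_of_lt_csInf' h
  by_contra! hc
  exact this ⟨R, rfl, hR, hc⟩

/-- If the sets `S t ⊆ Λ` realise every pattern on fewer than `κ` points `#T` times, and fewer
than `#T` of them contain or avoid a given set of cardinality `κ`, then the dual family
`{t | ξ ∈ S t}`, `ξ ∈ Λ`, is `κ`-barely independent. -/
theorem kBarelyIndependent_range {T Λ : Type} {κ : Cardinal} (hκ : ℵ₀ ≤ κ) (hκΛ : κ ≤ #Λ)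
    (S : T → Set Λ)
    (hsmall : ∀ A D : Set Λ, #A < κ → #{t | S t ∩ A = D ∩ A} = #T)
    (hlarge : ∀ B : Set Λ, #B = κ → #{t | B ⊆ S t ∨ Disjoint B (S t)} < #T) :
    KBarelyIndependent κ (range fun ξ ↦ {t | ξ ∈ S t}) ∧
      #(range fun ξ ↦ {t | ξ ∈ S t}) = #Λ := by
  set fam : Λ → Set T := fun ξ ↦ {t | ξ ∈ S t}
  have hmemfam (t ξ) : t ∈ fam ξ ↔ ξ ∈ S t := Iff.rfl
  have hT : #T ≠ 0 := by
    obtain ⟨B, hB⟩ := le_mk_iff_exists_set.1 hκΛ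
    exact (pos_of_gt (hlarge B hB)).ne'
  have hinj : Function.Injective fam := fun ξ η h ↦ by
    by_contra hne
    have hpat := hsmall {ξ, η} {ξ} ((Set.toFinite _).lt_aleph0.trans_le hκ)
    rw [← hpat, mk_ne_zero_iff] at hT
    obtain ⟨t, ht : S t ∩ {ξ, η} = {ξ} ∩ {ξ, η}⟩ := hT
    have h1 := Set.ext_iff.1 ht ξ
    have h2 := Set.ext_iff.1 ht η
    have h3 := Set.ext_iff.1 h t
    rw [hmemfam, hmemfam] at h3
    simp only [mem_inter_iff, mem_insert_iff, mem_singleton_iff] at h1 h2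
    tauto
  have hcomb (𝓐 : Set (Set T)) (h𝓐 : 𝓐 ⊆ range fam) (h : Set T → Fin 2) :
      BoolComb 𝓐 h = {t | S t ∩ fam ⁻¹' 𝓐 = {ξ | h (fam ξ) = 0} ∩ fam ⁻¹' 𝓐} := by
    have key (t : T) (A : Set T) :
        t ∈ (if h A = 0 then A else Aᶜ) ↔ (t ∈ A ↔ h A = 0) := by
      split_ifs with hA <;> simp [hA]
    ext t
    simp only [BoolComb, mem_iInter, key, mem_ofPred_eq, Set.ext_iff, mem_inter_iff, mem_preimage]
    refine ⟨fun H ξ ↦ and_congr_left fun hξ ↦ H _ hξ, fun H A hA ↦ ?_⟩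
    obtain ⟨ξ, rfl⟩ := h𝓐 hA
    exact (and_congr_left_iff.1 (H ξ)) hA
  have hcard (𝓐 : Set (Set T)) (h𝓐 : 𝓐 ⊆ range fam) : #(fam ⁻¹' 𝓐) = #𝓐 :=
    mk_preimage_of_injective_of_subset_range _ _ hinj h𝓐
  have hrange : #(range fam) = #Λ := mk_range_eq _ hinj
  refine ⟨⟨hrange ▸ hκΛ, ?_, ?_, ?_⟩, hrange⟩
  · rintro _ ⟨ξ, rfl⟩
    rw [← hsmall {ξ} univ ((Set.toFinite _).lt_aleph0.trans_le hκ)]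
    congr 2
    ext t
    simp [hmemfam]
  · intro 𝓐 h𝓐 _ hlt h
    rw [hcomb 𝓐 h𝓐]
    exact hsmall _ _ (by rwa [hcard 𝓐 h𝓐])
  · intro 𝓐 h𝓐 heq h
    rw [hcomb 𝓐 h𝓐]
    set A := fam ⁻¹' 𝓐
    set D := {ξ | h (fam ξ) = 0}
    have hA : #A = κ := (hcard 𝓐 h𝓐).trans heq
    by_cases hD : #(A ∩ D : Set Λ) = κ
    · refine (mk_le_mk_of_subset fun t ht ↦ Or.inl fun ξ hξ ↦ ?_).trans_lt (hlarge _ hD)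
      exact ((Set.ext_iff.1 ht ξ).2 ⟨hξ.2, hξ.1⟩).1
    · have hD' : #(A ∩ D : Set Λ) < #A :=
        (mk_le_mk_of_subset inter_subset_left).lt_of_ne (hA ▸ hD)
      have hAD := mk_sdiff_eq_of_lt (hA ▸ hκ) hD'
      rw [hA] at hAD
      refine (mk_le_mk_of_subset fun t ht ↦ Or.inr ?_).trans_lt (hlarge _ hAD)
      refine disjoint_left.2 fun ξ hξ hS ↦ hξ.2 ⟨hξ.1, ?_⟩
      exact ((Set.ext_iff.1 ht ξ).1 ⟨hS, hξ.1⟩).1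

/-- Let `κ` be an infinite regular cardinal, `μ = cof(2^κ)`, and let `lam` be an infinite
cardinal with `κ ≤ lam`, `lam ≤ μ` and `lam^{<κ} ≤ μ`. If `𝔯(κ, lam) = 2^κ`, then there is
a `κ`-barely independent family over `μ` of cardinality `lam`. -/
theorem stmt9 (κ lam : Cardinal) (hκ : ℵ₀ ≤ κ) (hκreg : κ.IsRegular)
    (hlam : ℵ₀ ≤ lam) (hκlam : κ ≤ lam)
    (hlamμ : lam ≤ ((2 ^ κ : Cardinal)).ord.cof) (hpow : lam ^< κ ≤ ((2 ^ κ : Cardinal)).ord.cof)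
    (hr : reapingNumber κ lam = 2 ^ κ) :
    ∃ I : Set (Set (((2 ^ κ : Cardinal)).ord.cof).out), KBarelyIndependent κ I ∧ #I = lam := by
  set μ := ((2 ^ κ : Cardinal)).ord.cof
  have hΛ : #lam.out = lam := mk_out _
  have hT : #μ.out = μ := mk_out _
  have hTinf : ℵ₀ ≤ #μ.out := hlam.trans (hlamμ.trans hT.ge)
  have hX : #{B : Set lam.out // #B = κ} ≤ 2 ^ κ := by
    calc _ ≤ #{B : Set lam.out // #B ≤ κ} := mk_subtype_mono fun B hB ↦ le_of_eq hB
      _ ≤ lam ^ κ := by simpa [hΛ, max_eq_left hlam] using mk_bounded_set_le lam.out κ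
      _ ≤ (2 ^ κ) ^ κ := power_le_power_right (hlamμ.trans (Ordinal.cof_ord_le _))
      _ = 2 ^ κ := by rw [← power_mul, mul_eq_self hκ]
  obtain ⟨F, hFlt, hF⟩ := exists_filtration_of_mk_le hX hT hTinf
  have hP : #{A : Set lam.out // #A < κ} ≤ #μ.out := by
    refine (mk_subsets_lt_le (hΛ.symm ▸ hlam)).trans ?_
    rw [hΛ, hT]
    exact mul_le_of_le (hlam.trans hlamμ) (hκlam.trans hlamμ) hpow
  have : Nonempty {A : Set lam.out // #A < κ} := ⟨∅, by simpa using aleph0_pos.trans_le hκ⟩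
  obtain ⟨p, hp⟩ := exists_fiber_mk_eq
    (P := {A : Set lam.out // #A < κ} × {A : Set lam.out // #A < κ}) hTinf (by
      rw [mk_prod, lift_id]
      exact mul_le_of_le hTinf hP hP)
  have hsplit (t : μ.out) : ∃ S : Set lam.out, ∀ B ∈ F t, Splits S (B.1 \ (p t).1.1) := by
    obtain ⟨S, hS⟩ := exists_splits_of_mk_lt_reapingNumber (κ := κ)
      (R := (fun B ↦ B.1 \ (p t).1.1) '' F t) (by
        rintro _ ⟨B, -, rfl⟩
        exact (mk_sdiff_eq_of_lt (B.2.symm ▸ hκ) (B.2.symm ▸ (p t).1.2)).trans B.2)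
      (by rw [hr]; exact mk_image_le.trans_lt (hFlt t))
    exact ⟨S, fun B hB ↦ hS _ ⟨B, hB, rfl⟩⟩
  choose S₀ hS₀ using hsplit
  let S (t : μ.out) : Set lam.out := (S₀ t \ (p t).1.1) ∪ ((p t).2.1 ∩ (p t).1.1)
  obtain ⟨hI, hcard⟩ := kBarelyIndependent_range (T := μ.out) hκ (hΛ.symm ▸ hκlam) S
    (fun A D hA ↦ by
      have hD : #(D ∩ A : Set lam.out) < κ := (mk_le_mk_of_subset inter_subset_right).trans_lt hA
      refine (mk_set_le _).antisymm ?_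
      rw [← hp (⟨A, hA⟩, ⟨D ∩ A, hD⟩)]
      refine mk_le_mk_of_subset fun t (ht : p t = _) ↦ ?_
      simp only [S, mem_ofPred_eq, ht]
      ext ξ
      simp only [mem_inter_iff, mem_union, mem_sdiff]
      tauto)
    (fun B hB ↦ by
      refine (mk_le_mk_of_subset fun t ht hBF ↦ ?_).trans_lt (hF ⟨B, hB⟩)
      obtain ⟨h1, h2⟩ := hS₀ t _ hBF
      obtain ⟨ξ, hξ, hξS⟩ := h1.nonempty
      obtain ⟨η, hη, hηS⟩ := h2.nonempty
      obtain hsub | hdisj := ht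
      · obtain h | h := hsub hη.1
        · exact hηS h.1
        · exact hη.2 h.2
      · exact disjoint_left.1 hdisj hξ.1 (Or.inl ⟨hξS, hξ.2⟩))
  exact ⟨_, hI, hcard.trans hΛ⟩
end

section
/- If 𝔭 > ω₁, then there is no barely independent family over ω₁. -/
open Cardinal Set

/-- The pseudo-intersection number `𝔭`: the least cardinality of a family `F` of infinite
subsets of `ω` with the finite intersection property admitting no infinite pseudo-intersection. -/
noncomputable def pseudoNumber : Cardinal :=
  sInf {c | ∃ F : Set (Set ℕ), #F = c ∧ (∀ A ∈ F, A.Infinite) ∧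
    (∀ G ⊆ F, G.Finite → G.Nonempty → (⋂₀ G).Infinite) ∧
    ¬ ∃ A : Set ℕ, A.Infinite ∧ ∀ B ∈ F, (A \ B).Finite}

/-- A family of fewer than `𝔭` members of the hyperfilter has an infinite pseudo-intersection. -/
theorem exists_pseudoIntersection_of_mem_hyperfilter {F : Set (Set ℕ)} (hF : #F < pseudoNumber)
    (hU : ∀ A ∈ F, A ∈ Filter.hyperfilter ℕ) :
    ∃ B : Set ℕ, B.Infinite ∧ ∀ A ∈ F, (B \ A).Finite := by
  by_contra hB
  have infinite_of_mem {A : Set ℕ} (hA : A ∈ Filter.hyperfilter ℕ) : A.Infinite :=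
    fun hfin => hfin.notMem_hyperfilter hA
  refine notMem_of_lt_csInf' hF ⟨F, rfl, fun A hA => infinite_of_mem (hU A hA), ?_, hB⟩
  intro G hG hfin _
  exact infinite_of_mem ((Filter.sInter_mem hfin).2 fun A hA => hU A (hG hA))

/-- Among uncountably many, but fewer than `𝔭`, subsets of `ω`, uncountably many contain a common
infinite set, or uncountably many are disjoint from a common infinite set. -/
theorem exists_infinite_not_countable {α : Type} [Uncountable α] (hα : #α < pseudoNumber)
    (x : α → Set ℕ) :
    ∃ B : Set ℕ, B.Infinite ∧
      (¬ {a | B ⊆ x a}.Countable ∨ ¬ {a | B ⊆ (x a)ᶜ}.Countable) := by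
  by_contra! hcount
  have countable_preimage (y : α → Set ℕ)
      (hy : ∀ B : Set ℕ, B.Infinite → {a | B ⊆ y a}.Countable) :
      {a | y a ∈ Filter.hyperfilter ℕ}.Countable := by
    obtain ⟨B, hB, hBy⟩ := exists_pseudoIntersection_of_mem_hyperfilter
      (F := y '' {a | y a ∈ Filter.hyperfilter ℕ})
      ((mk_image_le.trans (mk_set_le _)).trans_lt hα) (by rintro _ ⟨a, ha, rfl⟩; exact ha)
    refine (countable_iUnion fun k : ℕ => hy (B \ Iio k) (hB.sdiff (finite_Iio k))).mono ?_
    intro a ha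
    obtain ⟨k, hk⟩ := (hBy _ (mem_image_of_mem y ha)).bddAbove
    refine mem_iUnion.2 ⟨k + 1, fun n hn => ?_⟩
    by_contra hna
    exact hn.2 (Nat.lt_succ_of_le (hk ⟨hn.1, hna⟩))
  refine not_countable_univ (α := α) (((countable_preimage x fun B hB => (hcount B hB).1).union
    (countable_preimage (fun a => (x a)ᶜ) fun B hB => (hcount B hB).2)).mono fun a _ => ?_)
  exact (Filter.hyperfilter ℕ).mem_or_compl_mem (x a)

/-- If `𝔭 > ω₁`, then no set of cardinality `ℵ₁` carries a barely independent family. -/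
theorem not_exists_kBarelyIndependent_aleph0 {α : Type} (hα : #α = Cardinal.aleph 1)
    (hp : Cardinal.aleph 1 < pseudoNumber) :
    ¬ ∃ I : Set (Set α), KBarelyIndependent ℵ₀ I := by
  rintro ⟨I, hI, -, -, hsmall⟩
  have : Infinite I := infinite_iff.2 hI
  have : Uncountable α := by
    rw [← aleph0_lt_mk_iff, hα]
    exact aleph0_lt_aleph_one
  let e := Infinite.natEmbedding I
  have countable_boolComb (B : Set ℕ) (hB : B.Infinite) (h : Set α → Fin 2) :
      (BoolComb ((fun n => (e n : Set α)) '' B) h).Countable := by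
    have hcard : #((fun n => (e n : Set α)) '' B) = ℵ₀ := by
      have : Infinite B := hB.to_subtype
      exact (mk_image_eq (Subtype.val_injective.comp e.injective)).trans (mk_eq_aleph0 B)
    have hlt := hsmall _ (by rintro _ ⟨n, -, rfl⟩; exact (e n).2) hcard h
    rwa [hα, ← succ_aleph0, Order.lt_succ_iff, le_aleph0_iff_set_countable] at hlt
  obtain ⟨B, hB, hx | hx⟩ := exists_infinite_not_countable (hα.trans_lt hp)
    fun a : α => {n | a ∈ (e n : Set α)}
  · refine hx ((countable_boolComb B hB fun _ => 0).mono fun a ha => ?_)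
    simpa [BoolComb] using fun n hn => ha hn
  · refine hx ((countable_boolComb B hB fun _ => 1).mono fun a ha => ?_)
    simpa [BoolComb] using fun n hn => ha hn

/-- If `𝔭 > ω₁`, then there is no barely independent (i.e. `ℵ₀`-barely independent) family
over `ω₁`. -/
theorem stmt13 (hp : Cardinal.aleph 1 < pseudoNumber) :
    ¬ ∃ I : Set (Set (Cardinal.aleph 1).out), KBarelyIndependent ℵ₀ I :=
  not_exists_kBarelyIndependent_aleph0 (mk_out _) hp
end

section
/- Assume the Continuum Hypothesis, 2^{ℵ₀} = ℵ₁. Then there is a barely independent family over ω₁ of cardinality ℵ₁. -/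
open Cardinal Set

theorem exists_injective_mem_of_infinite {ι T : Type*} [Countable ι] (S : ι → Set T)
    (hS : ∀ a, (S a).Infinite) : ∃ m : ι → T, Function.Injective m ∧ ∀ a, m a ∈ S a := by
  classical
  obtain ⟨f, hf⟩ := exists_injective_nat ι
  choose t hts htc using fun a => (hS a).exists_subset_card_eq (f a + 1)
  obtain ⟨m, hm, hmt⟩ := (Finset.all_card_le_biUnion_card_iff_exists_injective t).1 (by
    intro s
    rcases s.eq_empty_or_nonempty with rfl | hs
    · simp
    obtain ⟨a, ha, hmax⟩ := s.exists_max_image f hs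
    calc s.card = (s.image f).card := (Finset.card_image_of_injective s hf).symm
      _ ≤ (Finset.range (f a + 1)).card := Finset.card_le_card (by
          intro k hk
          obtain ⟨b, hb, rfl⟩ := Finset.mem_image.1 hk
          exact Finset.mem_range.2 (Nat.lt_succ_of_le (hmax b hb)))
      _ = (t a).card := by rw [htc, Finset.card_range]
      _ ≤ (s.biUnion t).card := Finset.card_le_card (Finset.subset_biUnion_of_mem t ha))
  exact ⟨m, hm, fun a => hts a (hmt a)⟩

/-- A finite partial predicate extends to a total one differing somewhere from each of countably
many partial predicates with infinite domains. -/
theorem exists_extend_avoiding {ι T : Type*} [Countable ι] (F : Finset T) (p : T → Prop)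
    (e : ι → ℕ → T) (he : ∀ a, Function.Injective (e a)) (g : ι → ℕ → Prop) :
    ∃ x : T → Prop, (∀ i ∈ F, x i ↔ p i) ∧ ∀ a, ∃ n, ¬ (x (e a n) ↔ g a n) := by
  obtain ⟨m, hm, hmS⟩ := exists_injective_mem_of_infinite (fun a => range (e a) \ (F : Set T))
    fun a => (infinite_range_of_injective (he a)).sdiff F.finite_toSet
  choose n hn using fun a => (hmS a).1
  have hF : ∀ a, m a ∉ F := fun a => by simpa using (hmS a).2
  refine ⟨fun i => (i ∈ F ∧ p i) ∨ ∃ a, m a = i ∧ ¬ g a (n a), fun i hi => ?_, fun a => ⟨n a, ?_⟩⟩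
  · have : ¬ ∃ a, m a = i ∧ ¬ g a (n a) := by
      rintro ⟨a, rfl, -⟩
      exact hF a hi
    simp [hi, this]
  · have : (∃ b, m b = m a ∧ ¬ g b (n b)) ↔ ¬ g a (n a) :=
      ⟨fun ⟨b, hb, h⟩ => hm hb ▸ h, fun h => ⟨a, rfl, h⟩⟩
    simp [hn, hF a, this]

theorem exists_relation_countable_sections {T : Type*} (hT : #T = ℵ₁) :
    ∃ r : T → T → Prop, (∀ b, {a | r a b}.Countable) ∧ ∀ a, {b | ¬ r a b}.Countable := by
  obtain ⟨_, _, hr⟩ := Cardinal.exists_ord_eq_type_lt T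
  have hc : ∀ b : T, (Iio b).Countable := fun b => by
    rw [← Cardinal.le_aleph0_iff_set_countable, ← Order.lt_succ_iff, Cardinal.succ_aleph0, ← hT]
    exact Cardinal.mk_Iio_lt b hr
  refine ⟨(· < ·), hc, fun a => ((hc a).union (countable_singleton a)).mono fun b hb => ?_⟩
  exact lt_or_eq_of_le (not_lt.1 hb)

theorem exists_barely_independent_relation {T : Type} (hT : #T = ℵ₁)
    (hCH : (2 : Cardinal.{0}) ^ ℵ₀ = ℵ₁) :
    ∃ x : T → T → Prop,
      (∀ F G : Finset T, #{ξ | ∀ i ∈ F, x ξ i ↔ i ∈ G} = ℵ₁) ∧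
      ∀ e : ℕ → T, Function.Injective e → ∀ g : ℕ → Prop,
        {ξ | ∀ n, x ξ (e n) ↔ g n}.Countable := by
  have hle : ℵ₀ ≤ #T := hT ▸ Cardinal.aleph0_le_aleph 1
  have : Infinite T := Cardinal.infinite_iff.2 hle
  obtain ⟨s⟩ : Nonempty (T ≃ T × Finset T × Finset T) := Cardinal.eq.1 <| by
    simp [Cardinal.mk_finset_of_infinite, Cardinal.mul_eq_self hle]
  obtain ⟨c⟩ : Nonempty (T ≃ (ℕ → T) × (ℕ → Prop)) := Cardinal.eq.1 <| by
    have h : (#T) ^ ℵ₀ = #T := by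
      rw [hT, ← hCH, ← Cardinal.power_mul, Cardinal.aleph0_mul_aleph0]
    simp only [Cardinal.mk_prod, Cardinal.mk_pi, Cardinal.prod_const, Cardinal.lift_id,
      Cardinal.mk_nat, Cardinal.mk_Prop, h, hCH, ← hT, Cardinal.mul_eq_self hle]
  obtain ⟨r, hr, hr'⟩ := exists_relation_countable_sections hT
  have key : ∀ ξ, ∃ x : T → Prop, (∀ i ∈ (s ξ).2.1, x i ↔ i ∈ (s ξ).2.2) ∧
      ∀ a : {a | r a ξ ∧ Function.Injective (c a).1}, ∃ n, ¬ (x ((c a).1 n) ↔ (c a).2 n) :=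
    fun ξ => by
      have : Countable {a | r a ξ ∧ Function.Injective (c a).1} :=
        ((hr ξ).mono fun a ha => ha.1).to_subtype
      exact exists_extend_avoiding _ _ _ (fun a => a.2.2) _
  choose x hx hx' using key
  refine ⟨x, fun F G => le_antisymm (hT ▸ Cardinal.mk_set_le _) ?_, fun e he g => ?_⟩
  · rw [← hT]
    refine Cardinal.mk_le_of_injective
      (f := fun t : T => (⟨s.symm (t, F, G), by simpa using hx (s.symm (t, F, G))⟩ :
        {ξ | ∀ i ∈ F, x ξ i ↔ i ∈ G})) fun a b hab => ?_
    simpa using hab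
  · refine (hr' (c.symm (e, g))).mono fun ξ hξ => fun hrξ : r _ ξ => ?_
    obtain ⟨n, hn⟩ := hx' ξ ⟨c.symm (e, g), hrξ, by simpa using he⟩
    simp only [Equiv.apply_symm_apply] at hn
    exact hn (hξ n)

theorem exists_kBarelyIndependent {T : Type} (hT : #T = ℵ₁) (hCH : (2 : Cardinal.{0}) ^ ℵ₀ = ℵ₁) :
    ∃ I : Set (Set T), KBarelyIndependent ℵ₀ I ∧ #I = ℵ₁ := by
  classical
  obtain ⟨x, hx, hx'⟩ := exists_barely_independent_relation hT hCH
  set A : T → Set T := fun i => {ξ | x ξ i} with hA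
  have hinj : Function.Injective A := fun i j hij => by
    by_contra hne
    have h := hx {i, j} {i}
    obtain ⟨ξ, hξ⟩ : {ξ | ∀ k ∈ ({i, j} : Finset _), x ξ k ↔ k ∈ ({i} : Finset _)}.Nonempty := by
      rw [← Set.nonempty_coe_sort, ← Cardinal.mk_ne_zero_iff, h]
      exact (Cardinal.aleph_pos 1).ne'
    have h₁ : x ξ i := (hξ i (by simp)).2 (by simp)
    have h₂ : ξ ∈ A j := hij ▸ h₁
    exact hne (Finset.mem_singleton.1 ((hξ j (by simp)).1 h₂)).symm
  have hcard : #(range A) = ℵ₁ := by rw [Cardinal.mk_range_eq A hinj, hT]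
  refine ⟨range A, ⟨hcard.symm ▸ Cardinal.aleph0_le_aleph 1, ?_, ?_, ?_⟩, hcard⟩
  · rintro _ ⟨i, rfl⟩
    rw [hT, ← hx {i} {i}]
    simp [hA]
  · intro 𝓐 h𝓐 _ hfin h
    have hF : (A ⁻¹' 𝓐).Finite := (Cardinal.lt_aleph0_iff_set_finite.1 hfin).preimage hinj.injOn
    refine le_antisymm (Cardinal.mk_set_le _) ?_
    rw [hT, ← hx hF.toFinset (hF.toFinset.filter fun i => h (A i) = 0)]
    refine Cardinal.mk_le_mk_of_subset fun ξ hξ => mem_iInter₂.2 fun B hB => ?_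
    obtain ⟨i, rfl⟩ := h𝓐 hB
    have := hξ i (by simpa using hB)
    split_ifs with h0
    · exact this.2 (by simpa [h0] using hB)
    · exact fun hi => h0 (Finset.mem_filter.1 (this.1 hi)).2
  · intro 𝓐 h𝓐 hω h
    obtain ⟨f⟩ : Nonempty (ℕ ≃ 𝓐) := Cardinal.eq.1 (by rw [hω, Cardinal.mk_nat])
    choose e he using fun n => h𝓐 (f n).2
    have hei : Function.Injective e := fun a b hab =>
      f.injective (Subtype.ext (by rw [← he, ← he, hab]))
    rw [hT, ← Cardinal.succ_aleph0, Order.lt_succ_iff, Cardinal.le_aleph0_iff_set_countable]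
    refine (hx' e hei fun n => h (A (e n)) = 0).mono fun ξ hξ => ?_
    intro n
    have := mem_iInter₂.1 hξ (A (e n)) (he n ▸ (f n).2)
    split_ifs at this with h0
    · exact iff_of_true this h0
    · exact iff_of_false this h0

/-- Assuming the Continuum Hypothesis `2^{ℵ₀} = ℵ₁`, there is a barely independent
(i.e. `ℵ₀`-barely independent) family over `ω₁` of cardinality `ℵ₁`. -/
theorem stmt15 (hCH : (2 : Cardinal) ^ ℵ₀ = Cardinal.aleph 1) :
    ∃ I : Set (Set (Cardinal.aleph 1).out),
      KBarelyIndependent ℵ₀ I ∧ #I = Cardinal.aleph 1 := by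
  refine exists_kBarelyIndependent (Cardinal.mk_out _) (Cardinal.lift_injective ?_)
  simpa using hCH
end
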